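/- For every positive integer n, t(2,3,3,8;2n) + t(1,1,6,24;2n-2) = t(1,1,3,3;n). Consequently, if n+1 = 2^α * 3^β * n1 with n1 coprime to 6, then t(1,1,6,24;2n-2) + t(2,3,3,8;2n) = 2^(α+4) * σ(n1), where σ is the sum-of-divisors function. -/

import Mathlib

/-- Number of representations of `n` by `a x² + b y² + c z² + d w²` over ℤ. -/
noncomputable def N4 (a b c d n : ℤ) : ℕ :=
  Set.ncard {v : ℤ × ℤ × ℤ × ℤ |
    n = a * v.1 ^ 2 + b * v.2.1 ^ 2 + c * v.2.2.1 ^ 2 + d * v.2.2.2 ^ 2}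

/-- Number of representations of `n` by `a x(x-1)/2 + b y(y-1)/2 + c z(z-1)/2 + d w(w-1)/2`. -/
noncomputable def t4 (a b c d n : ℤ) : ℕ :=
  Set.ncard {v : ℤ × ℤ × ℤ × ℤ |
    2 * n = a * (v.1 * (v.1 - 1)) + b * (v.2.1 * (v.2.1 - 1))
      + c * (v.2.2.1 * (v.2.2.1 - 1)) + d * (v.2.2.2 * (v.2.2.2 - 1))}


lemma nb {α β : Type*} {s : Set α} {t : Set β} (f : α → β) (g : β → α)
    (hf : ∀ a ∈ s, f a ∈ t) (hg : ∀ b ∈ t, g b ∈ s)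
    (h1 : ∀ a ∈ s, g (f a) = a) (h2 : ∀ b ∈ t, f (g b) = b) : s.ncard = t.ncard := by
  refine Set.ncard_congr (fun a _ => f a) hf ?_ ?_
  · intro a b ha hb h
    rw [← h1 a ha, ← h1 b hb, h]
  · intro b hb
    exact ⟨g b, hg b hb, h2 b hb⟩

def rS (k : ℤ) : Set (ℤ × ℤ) := {v | v.1 ^ 2 + 3 * v.2 ^ 2 = k}
def oS (k : ℤ) : Set (ℤ × ℤ) := {v | v.1 * (v.1 - 1) + 3 * (v.2 * (v.2 - 1)) + 1 = k}

lemma rS_fin (k : ℤ) : (rS k).Finite := by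
  refine Set.Finite.subset (Set.finite_Icc ((-|k|, -|k|) : ℤ × ℤ) (|k|, |k|)) ?_
  rintro ⟨x, y⟩ h
  simp only [rS, Set.mem_ofPred_eq] at h
  have hk : k ≤ |k| := le_abs_self k
  have : x ≤ |k| := by nlinarith
  have : -|k| ≤ x := by nlinarith
  have : y ≤ |k| := by nlinarith
  have : -|k| ≤ y := by nlinarith
  simp [Prod.le_def]; omega

lemma oS_fin (k : ℤ) : (oS k).Finite := by
  refine Set.Finite.subset (Set.finite_Icc ((-|k|-2, -|k|-2) : ℤ × ℤ) (|k|+2, |k|+2)) ?_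
  rintro ⟨x, y⟩ h
  simp only [oS, Set.mem_ofPred_eq] at h
  have hk : k ≤ |k| := le_abs_self k
  have h1 : 0 ≤ x * (x-1) := by
    rcases le_or_gt x 0 with h | h <;> nlinarith
  have h2 : 0 ≤ y * (y-1) := by
    rcases le_or_gt y 0 with h | h <;> nlinarith
  have : x ≤ |k|+2 := by nlinarith
  have : -|k|-2 ≤ x := by nlinarith
  have : y ≤ |k|+2 := by nlinarith
  have : -|k|-2 ≤ y := by nlinarith
  simp only [Set.mem_Icc, Prod.mk_le_mk]; omega

lemma rS_nonneg {k : ℤ} {v} (h : v ∈ rS k) : 0 ≤ k := by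
  simp only [rS, Set.mem_ofPred_eq] at h
  rw [← h]; positivity

lemma oS_nonneg {k : ℤ} {v} (h : v ∈ oS k) : 0 ≤ k := by
  simp only [oS, Set.mem_ofPred_eq] at h
  nlinarith [sq_nonneg (2 * v.1 - 1), sq_nonneg (2 * v.2 - 1)]

lemma mul_pred_even (x : ℤ) : ∃ c, x * (x - 1) = 2 * c := by
  have := Int.even_mul_pred_self x
  obtain ⟨c, hc⟩ := this
  exact ⟨c, by omega⟩

lemma oS_even {k : ℤ} (hk : k % 2 = 0) : (oS k).ncard = 0 := by
  rw [Set.ncard_eq_zero (oS_fin k)]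
  ext ⟨x, y⟩
  simp only [oS, Set.mem_ofPred_eq, Set.mem_empty_iff_false, iff_false]
  intro h
  obtain ⟨a, ha⟩ := mul_pred_even x
  obtain ⟨b, hb⟩ := mul_pred_even y
  omega

lemma sq_par (x : ℤ) : ∃ c, x ^ 2 = 2 * c + x := by
  obtain ⟨a, ha⟩ := mul_pred_even x
  exact ⟨a, by linarith⟩

lemma oS_odd {k : ℤ} (hk : k % 2 = 1) : (oS k).ncard = 2 * (rS k).ncard := by
  have e1 : oS k = {v ∈ oS k | (v.1 - v.2) % 2 = 0} ∪ {v ∈ oS k | (v.1 - v.2) % 2 = 1} := by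
    ext v; simp only [Set.mem_union, Set.mem_ofPred_eq]
    have := Int.emod_two_eq_zero_or_one (v.1 - v.2)
    tauto
  have e2 : {v ∈ oS k | (v.1 - v.2) % 2 = 0}.ncard = {v ∈ oS k | (v.1 - v.2) % 2 = 1}.ncard := by
    apply nb (fun v => (v.1, 1 - v.2)) (fun v => (v.1, 1 - v.2))
    · rintro ⟨x, y⟩ ⟨h, h'⟩
      simp only [oS, Set.mem_ofPred_eq] at *
      exact ⟨by linarith, by omega⟩
    · rintro ⟨x, y⟩ ⟨h, h'⟩
      simp only [oS, Set.mem_ofPred_eq] at *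
      exact ⟨by linarith, by omega⟩
    · rintro ⟨x, y⟩ _; simp
    · rintro ⟨x, y⟩ _; simp
  have e3 : {v ∈ oS k | (v.1 - v.2) % 2 = 0}.ncard = (rS k).ncard := by
    apply nb (fun v => ((v.1 + 3 * v.2 - 2) / 2, (v.2 - v.1) / 2))
      (fun v => ((v.1 + v.2 + 1) / 2 - 2 * v.2, (v.1 + v.2 + 1) / 2))
    · rintro ⟨x, y⟩ ⟨h, h'⟩
      simp only [oS, rS, Set.mem_ofPred_eq] at *
      obtain ⟨c, rfl⟩ : ∃ c, x = y - 2 * c := ⟨(y - x) / 2, by omega⟩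
      rw [show (y - 2 * c + 3 * y - 2) / 2 = 2 * y - c - 1 by omega,
        show (y - (y - 2 * c)) / 2 = c by omega]
      linarith
    · rintro ⟨x, y⟩ h
      simp only [oS, rS, Set.mem_ofPred_eq] at *
      obtain ⟨a, ha⟩ := sq_par x
      obtain ⟨b, hb⟩ := sq_par y
      obtain ⟨c, rfl⟩ : ∃ c, x = 2 * c - y - 1 := ⟨(x + y + 1) / 2, by omega⟩
      rw [show (2 * c - y - 1 + y + 1) / 2 = c by omega]
      exact ⟨by linarith, by omega⟩
    · rintro ⟨x, y⟩ ⟨h, h'⟩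
      simp only [oS, rS, Set.mem_ofPred_eq, Prod.mk.injEq] at *
      omega
    · rintro ⟨x, y⟩ h
      simp only [oS, rS, Set.mem_ofPred_eq, Prod.mk.injEq] at *
      obtain ⟨a, ha⟩ := sq_par x
      obtain ⟨b, hb⟩ := sq_par y
      omega
  rw [e1, Set.ncard_union_eq _ ((oS_fin k).subset (Set.sep_subset _ _))
    ((oS_fin k).subset (Set.sep_subset _ _)), ← e2, e3]
  · ring
  · rw [Set.disjoint_left]
    rintro v ⟨_, h⟩ ⟨_, h'⟩
    omega

def prS (A B : ℤ → Set (ℤ × ℤ)) (M : ℤ) : Set ((ℤ × ℤ) × (ℤ × ℤ)) :=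
  {v | ∃ k, v.1 ∈ A k ∧ v.2 ∈ B (M - k)}

lemma prS_eq (A B : ℤ → Set (ℤ × ℤ)) (M : ℤ)
    (hA : ∀ k v, v ∈ A k → 0 ≤ k) (hB : ∀ k v, v ∈ B k → 0 ≤ k) :
    prS A B M = ⋃ k ∈ Finset.Icc 0 M, A k ×ˢ B (M - k) := by
  ext v
  simp only [prS, Set.mem_ofPred_eq, Set.mem_iUnion, Set.mem_prod, Finset.mem_Icc]
  constructor
  · rintro ⟨k, h1, h2⟩
    have := hA _ _ h1
    have := hB _ _ h2
    exact ⟨k, by omega, h1, h2⟩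
  · rintro ⟨k, _, h1, h2⟩
    exact ⟨k, h1, h2⟩

lemma prS_fin (A B : ℤ → Set (ℤ × ℤ)) (M : ℤ)
    (hA : ∀ k v, v ∈ A k → 0 ≤ k) (hB : ∀ k v, v ∈ B k → 0 ≤ k)
    (fA : ∀ k, (A k).Finite) (fB : ∀ k, (B k).Finite) : (prS A B M).Finite := by
  rw [prS_eq A B M hA hB]
  exact Set.Finite.biUnion (Finset.finite_toSet _) (fun k _ => (fA k).prod (fB _))

lemma prS_card (A B : ℤ → Set (ℤ × ℤ)) (M : ℤ)
    (hA : ∀ k v, v ∈ A k → 0 ≤ k) (hB : ∀ k v, v ∈ B k → 0 ≤ k)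
    (fA : ∀ k, (A k).Finite) (fB : ∀ k, (B k).Finite)
    (dA : ∀ k l v, v ∈ A k → v ∈ A l → k = l) :
    (prS A B M).ncard = ∑ k ∈ Finset.Icc 0 M, (A k).ncard * (B (M - k)).ncard := by
  classical
  have : prS A B M = ↑((Finset.Icc 0 M).biUnion
      (fun k => (fA k).toFinset ×ˢ (fB (M - k)).toFinset)) := by
    rw [prS_eq A B M hA hB]
    ext v; simp
  rw [this, Set.ncard_coe_finset, Finset.card_biUnion]
  · refine Finset.sum_congr rfl fun k _ => ?_
    rw [Finset.card_product, Set.ncard_eq_toFinset_card _ (fA k),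
      Set.ncard_eq_toFinset_card _ (fB (M - k))]
  · intro k _ l _ hkl
    rw [Function.onFun, Finset.disjoint_left]
    rintro v h1 h2
    simp at h1 h2
    exact hkl (dA _ _ _ h1.1 h2.1)

lemma oS_dj (k l : ℤ) (v : ℤ × ℤ) (h : v ∈ oS k) (h' : v ∈ oS l) : k = l := by
  simp only [oS, Set.mem_ofPred_eq] at *; omega

lemma t1133_eq (n : ℤ) : t4 1 1 3 3 n =
    ∑ k ∈ Finset.Icc 0 (2 * n + 2), (oS k).ncard * (oS (2 * n + 2 - k)).ncard := by
  rw [← prS_card oS oS _ (fun k v => oS_nonneg) (fun k v => oS_nonneg) oS_fin oS_fin oS_dj]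
  apply nb (fun v => ((v.1, v.2.2.1), (v.2.1, v.2.2.2)))
    (fun v => (v.1.1, v.2.1, v.1.2, v.2.2))
  · rintro ⟨x, y, z, w⟩ h
    simp only [prS, oS, Set.mem_ofPred_eq] at *
    exact ⟨_, rfl, by linarith⟩
  · rintro ⟨⟨x, y⟩, ⟨z, w⟩⟩ ⟨k, h, h'⟩
    simp only [prS, oS, Set.mem_ofPred_eq] at *
    linarith
  · intro v _; rfl
  · intro v _; rfl

lemma split2 {α : Type*} (s : Set α) (hs : s.Finite) (f : α → ℤ) :
    s.ncard = {v ∈ s | f v % 2 = 0}.ncard + {v ∈ s | f v % 2 = 1}.ncard := by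
  rw [← Set.ncard_union_eq _ (hs.subset (Set.sep_subset _ _)) (hs.subset (Set.sep_subset _ _))]
  · congr 1
    ext v; simp only [Set.mem_union, Set.mem_ofPred_eq]
    have := Int.emod_two_eq_zero_or_one (f v)
    tauto
  · rw [Set.disjoint_left]
    rintro v ⟨_, h⟩ ⟨_, h'⟩
    omega

lemma t_fin (a b c d n : ℤ) (ha : 0 < a) (hb : 0 < b) (hc : 0 < c) (hd : 0 < d) :
    {v : ℤ × ℤ × ℤ × ℤ |
    2 * n = a * (v.1 * (v.1 - 1)) + b * (v.2.1 * (v.2.1 - 1))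
      + c * (v.2.2.1 * (v.2.2.1 - 1)) + d * (v.2.2.2 * (v.2.2.2 - 1))}.Finite := by
  have key : ∀ x : ℤ, 0 ≤ x * (x - 1) := by
    intro x
    rcases le_or_gt x 0 with h | h <;> nlinarith
  have key2 : ∀ a x : ℤ, 0 < a → a * (x * (x - 1)) ≤ 2 * n → -|2 * n| - 2 ≤ x ∧ x ≤ |2 * n| + 2 := by
    intro a x ha h
    have h1 := key x
    have h2 : x * (x - 1) ≤ |2 * n| := by
      have := le_abs_self (2 * n)
      nlinarith
    constructor <;> nlinarith
  set m := |2 * n| + 2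
  refine Set.Finite.subset (Set.finite_Icc ((-m, -m, -m, -m) : ℤ × ℤ × ℤ × ℤ) (m, m, m, m)) ?_
  rintro ⟨x, y, z, w⟩ h
  simp only [Set.mem_ofPred_eq] at h
  have hx := mul_nonneg ha.le (key x)
  have hy := mul_nonneg hb.le (key y)
  have hz := mul_nonneg hc.le (key z)
  have hw := mul_nonneg hd.le (key w)
  have := key2 a x ha (by linarith)
  have := key2 b y hb (by linarith)
  have := key2 c z hc (by linarith)
  have := key2 d w hd (by linarith)
  simp only [Set.mem_Icc, Prod.mk_le_mk]; omega

lemma tF (n : ℤ) : t4 2 3 3 8 (2 * n) = 2 * {v ∈ prS oS rS (2 * n + 2) | v.2.1 % 2 = 1}.ncard := by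
  unfold t4
  rw [split2 _ (t_fin 2 3 3 8 (2 * n) (by norm_num) (by norm_num) (by norm_num) (by norm_num))
    (fun v => v.2.1 + v.2.2.1)]
  have e : {v : ℤ × ℤ × ℤ × ℤ | v ∈ {v : ℤ × ℤ × ℤ × ℤ |
    2 * (2 * n) = 2 * (v.1 * (v.1 - 1)) + 3 * (v.2.1 * (v.2.1 - 1))
      + 3 * (v.2.2.1 * (v.2.2.1 - 1)) + 8 * (v.2.2.2 * (v.2.2.2 - 1))} ∧
        (v.2.1 + v.2.2.1) % 2 = 0}.ncard = {v ∈ prS oS rS (2 * n + 2) | v.2.1 % 2 = 1}.ncard := by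
    apply nb (fun v => ((v.1, (v.2.1 + v.2.2.1) / 2), (2 * v.2.2.2 - 1, (v.2.1 - v.2.2.1) / 2)))
      (fun v => (v.1.1, v.1.2 + v.2.2, v.1.2 - v.2.2, (v.2.1 + 1) / 2))
    · rintro ⟨x, y, z, w⟩ ⟨h, h'⟩
      simp only [prS, oS, rS, Set.mem_ofPred_eq] at *
      obtain ⟨c, rfl⟩ : ∃ c, y = 2 * c - z := ⟨(y + z) / 2, by omega⟩
      rw [show (2 * c - z + z) / 2 = c by omega, show (2 * c - z - z) / 2 = c - z by omega]
      exact ⟨⟨_, rfl, by linarith⟩, by omega⟩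
    · rintro ⟨⟨x, y⟩, ⟨z, w⟩⟩ ⟨⟨k, h, h'⟩, h''⟩
      simp only [prS, oS, rS, Set.mem_ofPred_eq] at *
      obtain ⟨c, rfl⟩ : ∃ c, z = 2 * c - 1 := ⟨(z + 1) / 2, by omega⟩
      rw [show (2 * c - 1 + 1) / 2 = c by omega]
      exact ⟨by linarith, by omega⟩
    · rintro ⟨x, y, z, w⟩ ⟨h, h'⟩
      simp only [Prod.mk.injEq] at *
      refine ⟨trivial, ?_, ?_, ?_⟩ <;> omega
    · rintro ⟨⟨x, y⟩, ⟨z, w⟩⟩ ⟨h, h'⟩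
      simp only [Prod.mk.injEq] at *
      refine ⟨⟨trivial, ?_⟩, ?_, ?_⟩ <;> omega
  rw [← e]
  refine Eq.trans ?_ (two_mul _).symm
  congr 1
  symm
  apply nb (fun v => (v.1, v.2.1, 1 - v.2.2.1, v.2.2.2)) (fun v => (v.1, v.2.1, 1 - v.2.2.1, v.2.2.2))
  · rintro ⟨x, y, z, w⟩ ⟨h, h'⟩
    simp only [Set.mem_ofPred_eq] at *
    exact ⟨by linarith, by omega⟩
  · rintro ⟨x, y, z, w⟩ ⟨h, h'⟩
    simp only [Set.mem_ofPred_eq] at *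
    exact ⟨by linarith, by omega⟩
  · rintro ⟨x, y, z, w⟩ _; simp
  · rintro ⟨x, y, z, w⟩ _; simp

lemma tG (n : ℤ) : t4 1 1 6 24 (2 * n - 2) =
    2 * {v ∈ prS oS rS (2 * n + 2) | v.2.1 % 2 = 0}.ncard := by
  unfold t4
  rw [split2 _ (t_fin 1 1 6 24 (2 * n - 2) (by norm_num) (by norm_num) (by norm_num) (by norm_num))
    (fun v => v.1 + v.2.1)]
  have e : {v : ℤ × ℤ × ℤ × ℤ | v ∈ {v : ℤ × ℤ × ℤ × ℤ |
    2 * (2 * n - 2) = 1 * (v.1 * (v.1 - 1)) + 1 * (v.2.1 * (v.2.1 - 1))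
      + 6 * (v.2.2.1 * (v.2.2.1 - 1)) + 24 * (v.2.2.2 * (v.2.2.2 - 1))} ∧
        (v.1 + v.2.1) % 2 = 0}.ncard = {v ∈ prS oS rS (2 * n + 2) | v.2.1 % 2 = 0}.ncard := by
    have par : ∀ x y z w k : ℤ, x * (x - 1) + 3 * (y * (y - 1)) + 1 = k →
        z ^ 2 + 3 * w ^ 2 = 2 * n + 2 - k → (z + w) % 2 = 1 := by
      intro x y z w k h h'
      obtain ⟨a, ha⟩ := mul_pred_even x
      obtain ⟨b, hb⟩ := mul_pred_even y
      obtain ⟨c, hc⟩ := sq_par z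
      obtain ⟨d, hd⟩ := sq_par w
      omega
    apply nb (fun v => (((v.1 + v.2.1) / 2, v.2.2.1), ((v.1 - v.2.1) / 2, 2 * v.2.2.2 - 1)))
      (fun v => (v.1.1 + v.2.1, v.1.1 - v.2.1, v.1.2, (v.2.2 + 1) / 2))
    · rintro ⟨x, y, z, w⟩ ⟨h, h'⟩
      simp only [prS, oS, rS, Set.mem_ofPred_eq] at *
      obtain ⟨c, rfl⟩ : ∃ c, x = 2 * c - y := ⟨(x + y) / 2, by omega⟩
      rw [show (2 * c - y + y) / 2 = c by omega, show (2 * c - y - y) / 2 = c - y by omega]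
      have h2 : (c - y) ^ 2 + 3 * (2 * w - 1) ^ 2 = 2 * n + 2 - (c * (c - 1) + 3 * (z * (z - 1)) + 1) := by
        linarith
      have := par _ _ _ _ _ rfl h2
      exact ⟨⟨_, rfl, h2⟩, by omega⟩
    · rintro ⟨⟨x, y⟩, ⟨z, w⟩⟩ ⟨⟨k, h, h'⟩, h''⟩
      simp only [prS, oS, rS, Set.mem_ofPred_eq] at *
      have := par _ _ _ _ _ h h'
      obtain ⟨c, rfl⟩ : ∃ c, w = 2 * c - 1 := ⟨(w + 1) / 2, by omega⟩
      rw [show (2 * c - 1 + 1) / 2 = c by omega]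
      exact ⟨by linarith, by omega⟩
    · rintro ⟨x, y, z, w⟩ ⟨h, h'⟩
      simp only [Prod.mk.injEq] at *
      refine ⟨?_, ?_, trivial, ?_⟩ <;> omega
    · rintro ⟨⟨x, y⟩, ⟨z, w⟩⟩ ⟨⟨k, h, h'⟩, h''⟩
      simp only [prS, oS, rS, Set.mem_ofPred_eq] at h h' h''
      have := par _ _ _ _ _ h h'
      simp only [Prod.mk.injEq] at *
      refine ⟨⟨?_, trivial⟩, ?_, ?_⟩ <;> omega
  rw [← e]
  refine Eq.trans ?_ (two_mul _).symm
  congr 1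
  symm
  apply nb (fun v => (v.1, 1 - v.2.1, v.2.2.1, v.2.2.2)) (fun v => (v.1, 1 - v.2.1, v.2.2.1, v.2.2.2))
  · rintro ⟨x, y, z, w⟩ ⟨h, h'⟩
    simp only [Set.mem_ofPred_eq] at *
    exact ⟨by linarith, by omega⟩
  · rintro ⟨x, y, z, w⟩ ⟨h, h'⟩
    simp only [Set.mem_ofPred_eq] at *
    exact ⟨by linarith, by omega⟩
  · rintro ⟨x, y, z, w⟩ _; simp
  · rintro ⟨x, y, z, w⟩ _; simp

lemma part1 (n : ℤ) : t4 2 3 3 8 (2*n) + t4 1 1 6 24 (2*n - 2) = t4 1 1 3 3 n := by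
  rw [tF, tG, ← mul_add, add_comm, ← split2 _ (prS_fin oS rS _ (fun k v => oS_nonneg)
    (fun k v => rS_nonneg) oS_fin rS_fin), t1133_eq, prS_card oS rS _ (fun k v => oS_nonneg)
    (fun k v => rS_nonneg) oS_fin rS_fin oS_dj, Finset.mul_sum]
  refine Finset.sum_congr rfl fun k _ => ?_
  rcases Int.emod_two_eq_zero_or_one k with h | h
  · rw [oS_even h]; simp
  · rw [oS_odd (k := 2 * n + 2 - k) (by omega)]; ring

lemma t1133_r (n : ℤ) : t4 1 1 3 3 n =
    4 * ∑ k ∈ (Finset.Icc 0 (2 * n + 2)).filter (fun k => k % 2 = 1),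
      (rS k).ncard * (rS (2 * n + 2 - k)).ncard := by
  rw [t1133_eq, Finset.sum_filter, Finset.mul_sum]
  refine Finset.sum_congr rfl fun k _ => ?_
  rcases Int.emod_two_eq_zero_or_one k with h | h
  · rw [oS_even h]; simp [h]
  · rw [oS_odd (k := 2 * n + 2 - k) (by omega), oS_odd h, if_pos h]; ring

def chi (n : ℕ) : ℤ := if n % 3 = 1 then 1 else if n % 3 = 2 then -1 else 0

lemma chi_mul (a b : ℕ) : chi (a * b) = chi a * chi b := by
  unfold chi
  rw [Nat.mul_mod]
  have ha : a % 3 < 3 := Nat.mod_lt _ (by norm_num)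
  have hb : b % 3 < 3 := Nat.mod_lt _ (by norm_num)
  interval_cases a % 3 <;> interval_cases b % 3 <;> simp

def gg (m : ℕ) : ℤ := ∑ d ∈ m.divisors, chi d

lemma gg_rec (p m : ℕ) (hp : p.Prime) (hm : m ≠ 0) :
    gg (p * m) = gg m + chi p * gg m - chi p * (if p ∣ m then gg (m / p) else 0) := by
  classical
  have hp0 := hp.pos
  have hinj : Function.Injective (fun d => p * d) := fun a b h => Nat.eq_of_mul_eq_mul_left hp0 h
  have h1 : (p * m).divisors = m.divisors ∪ m.divisors.image (fun d => p * d) := by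
    ext d
    simp only [Finset.mem_union, Finset.mem_image, Nat.mem_divisors]
    constructor
    · rintro ⟨h, _⟩
      by_cases hd : p ∣ d
      · obtain ⟨e, rfl⟩ := hd
        exact Or.inr ⟨e, ⟨Nat.dvd_of_mul_dvd_mul_left hp0 h, hm⟩, rfl⟩
      · exact Or.inl ⟨Nat.Coprime.dvd_of_dvd_mul_left ((hp.coprime_iff_not_dvd.2 hd).symm) h, hm⟩
    · rintro (⟨h, _⟩ | ⟨e, ⟨h, _⟩, rfl⟩)
      · exact ⟨h.mul_left p, by positivity⟩
      · exact ⟨Nat.mul_dvd_mul_left p h, by positivity⟩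
  have hs : ∀ s : Finset ℕ, ∑ d ∈ s.image (fun d => p * d), chi d = chi p * ∑ d ∈ s, chi d := by
    intro s
    rw [Finset.sum_image (fun a _ b _ h => hinj h), Finset.mul_sum]
    exact Finset.sum_congr rfl fun d _ => chi_mul p d
  have h2 : ∑ d ∈ m.divisors ∩ m.divisors.image (fun d => p * d), chi d =
      chi p * (if p ∣ m then gg (m / p) else 0) := by
    split_ifs with h
    · rw [gg, ← hs]
      congr 1
      obtain ⟨e, rfl⟩ := h
      rw [Nat.mul_div_cancel_left _ hp0]
      have he : e ≠ 0 := by rintro rfl; simp at hm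
      ext d
      simp only [Finset.mem_inter, Finset.mem_image, Nat.mem_divisors]
      constructor
      · rintro ⟨⟨h, _⟩, f, ⟨h', _⟩, rfl⟩
        exact ⟨f, ⟨Nat.dvd_of_mul_dvd_mul_left hp0 h, he⟩, rfl⟩
      · rintro ⟨f, ⟨h', _⟩, rfl⟩
        exact ⟨⟨Nat.mul_dvd_mul_left p h', hm⟩, f, ⟨h'.mul_left p, hm⟩, rfl⟩
    · rw [mul_zero]
      apply Finset.sum_eq_zero
      intro d hd
      simp only [Finset.mem_inter, Finset.mem_image, Nat.mem_divisors] at hd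
      obtain ⟨⟨h', _⟩, f, _, rfl⟩ := hd
      exact absurd ((Dvd.intro _ rfl).trans h') h
  have h3 := Finset.sum_union_inter (s₁ := m.divisors) (s₂ := m.divisors.image (fun d => p * d)) (f := chi)
  rw [← h1, h2, hs] at h3
  simp only [gg] at *
  linarith

lemma rS3 (m : ℤ) : (rS (3 * m)).ncard = (rS m).ncard := by
  apply nb (fun v => (v.2, v.1 / 3)) (fun v => (3 * v.2, v.1))
  · rintro ⟨x, y⟩ h
    simp only [rS, Set.mem_ofPred_eq] at *
    have h3 : (3 : ℤ) ∣ x := by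
      apply Int.prime_three.dvd_of_dvd_pow (n := 2)
      exact ⟨m - y ^ 2, by linarith⟩
    obtain ⟨c, rfl⟩ := h3
    rw [show 3 * c / 3 = c by omega]; linarith
  · rintro ⟨x, y⟩ h
    simp only [rS, Set.mem_ofPred_eq] at *
    linarith
  · rintro ⟨x, y⟩ h
    simp only [rS, Set.mem_ofPred_eq, Prod.mk.injEq] at *
    have h3 : (3 : ℤ) ∣ x := by
      apply Int.prime_three.dvd_of_dvd_pow (n := 2)
      exact ⟨m - y ^ 2, by linarith⟩
    constructor <;> first | trivial | omega
  · rintro ⟨x, y⟩ h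
    simp only [Prod.mk.injEq] at *
    constructor <;> first | trivial | omega

lemma inert (p : ℕ) (hp : p.Prime) (h2 : p ≠ 2) (h3 : p % 3 = 2) (x y : ℤ)
    (h : (p : ℤ) ∣ x ^ 2 + 3 * y ^ 2) : (p : ℤ) ∣ x ∧ (p : ℤ) ∣ y := by
  haveI := Fact.mk hp
  have hpi : Prime (p : ℤ) := Nat.prime_iff_prime_int.1 hp
  have hy : (p : ℤ) ∣ y := by
    by_contra hy
    have hy' : (y : ZMod p) ≠ 0 := by
      rwa [Ne, ZMod.intCast_zmod_eq_zero_iff_dvd]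
    have hh : (x : ZMod p) ^ 2 + 3 * (y : ZMod p) ^ 2 = 0 := by
      have := (ZMod.intCast_zmod_eq_zero_iff_dvd _ p).2 h
      exact_mod_cast this
    have two : (2 : ZMod p) ≠ 0 := by
      intro h
      have : ((2 : ℕ) : ZMod p) = 0 := by exact_mod_cast h
      rw [ZMod.natCast_eq_zero_iff] at this
      exact h2 ((Nat.prime_dvd_prime_iff_eq hp Nat.prime_two).1 this)
    have three : (3 : ZMod p) ≠ 0 := by
      intro h
      have : ((3 : ℕ) : ZMod p) = 0 := by exact_mod_cast h
      rw [ZMod.natCast_eq_zero_iff] at this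
      have := ((Nat.prime_dvd_prime_iff_eq hp Nat.prime_three).1 this)
      omega
    obtain ⟨s, hs⟩ : ∃ s : ZMod p, s ^ 2 = -3 := ⟨x / y, by field_simp; linear_combination hh⟩
    obtain ⟨w, hw⟩ : ∃ w : ZMod p, 2 * w = s - 1 := ⟨(s - 1) / 2, by field_simp⟩
    have hs' : s = 2 * w + 1 := by linear_combination -hw
    have hw2 : w ^ 2 + w + 1 = 0 := by
      have : 2 * 2 * (w ^ 2 + w + 1) = 0 := by rw [hs'] at hs; linear_combination hs
      simpa [two] using this
    have hw3 : w ^ 3 = 1 := by linear_combination (w - 1) * hw2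
    have hw1 : w ≠ 1 := by
      rintro rfl
      apply three; linear_combination hw2
    have ho : orderOf w = 3 := orderOf_eq_prime hw3 hw1
    have hw0 : w ≠ 0 := by rintro rfl; simp at hw2
    have := ZMod.orderOf_dvd_card_sub_one hw0
    rw [ho] at this
    have := hp.two_le
    omega
  refine ⟨?_, hy⟩
  have : (p : ℤ) ∣ x ^ 2 := by
    have h' : (p : ℤ) ∣ 3 * y ^ 2 := (hy.pow two_ne_zero).mul_left 3
    exact (Int.dvd_add_left h').1 h
  exact hpi.dvd_of_dvd_pow this

lemma rS_inert0 (p : ℕ) (hp : p.Prime) (h2 : p ≠ 2) (h3 : p % 3 = 2) (m : ℤ)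
    (hm : ¬ (p : ℤ) ∣ m) : (rS (p * m)).ncard = 0 := by
  rw [Set.ncard_eq_zero (rS_fin _)]
  ext ⟨x, y⟩
  simp only [rS, Set.mem_ofPred_eq, Set.mem_empty_iff_false, iff_false]
  intro h
  obtain ⟨⟨a, rfl⟩, ⟨b, rfl⟩⟩ := inert p hp h2 h3 x y ⟨m, h⟩
  apply hm
  refine ⟨a ^ 2 + 3 * b ^ 2, ?_⟩
  have hp0 : (p : ℤ) ≠ 0 := by exact_mod_cast hp.ne_zero
  apply mul_left_cancel₀ hp0
  linarith

lemma rS_scale (p : ℤ) (hp0 : p ≠ 0) (m : ℤ) :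
    {v ∈ rS (p * (p * m)) | p ∣ v.1 ∧ p ∣ v.2}.ncard = (rS m).ncard := by
  apply nb (fun v => (v.1 / p, v.2 / p)) (fun v => (p * v.1, p * v.2))
  · rintro ⟨x, y⟩ ⟨h, ⟨a, rfl⟩, ⟨b, rfl⟩⟩
    simp only [rS, Set.mem_ofPred_eq] at *
    rw [Int.mul_ediv_cancel_left _ hp0, Int.mul_ediv_cancel_left _ hp0]
    apply mul_left_cancel₀ hp0
    apply mul_left_cancel₀ hp0
    linarith
  · rintro ⟨x, y⟩ h
    simp only [rS, Set.mem_ofPred_eq] at *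
    refine ⟨?_, Dvd.intro _ rfl, Dvd.intro _ rfl⟩
    rw [← h]; ring
  · rintro ⟨x, y⟩ ⟨h, ⟨a, rfl⟩, ⟨b, rfl⟩⟩
    simp only
    rw [Int.mul_ediv_cancel_left _ hp0, Int.mul_ediv_cancel_left _ hp0]
  · rintro ⟨x, y⟩ h
    simp only
    rw [Int.mul_ediv_cancel_left _ hp0, Int.mul_ediv_cancel_left _ hp0]

lemma rS_inert1 (p : ℕ) (hp : p.Prime) (h2 : p ≠ 2) (h3 : p % 3 = 2) (m : ℤ) :
    (rS (p * (p * m))).ncard = (rS m).ncard := by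
  rw [← rS_scale p (by exact_mod_cast hp.ne_zero) m]
  congr 1
  ext v
  simp only [Set.mem_ofPred_eq]
  constructor
  · intro h
    exact ⟨h, inert p hp h2 h3 _ _ ⟨_, h⟩⟩
  · exact fun h => h.1

lemma split_ex (p : ℕ) (hp : p.Prime) (h2 : p ≠ 2) (h3 : p % 3 = 1) :
    ∃ a b : ℤ, a ^ 2 + 3 * b ^ 2 = p := by
  haveI := Fact.mk hp
  have hp2 := hp.two_le
  obtain ⟨s, hs⟩ : ∃ s : ZMod p, s ^ 2 = -3 := by
    haveI : Fact (Nat.Prime 3) := ⟨Nat.prime_three⟩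
    obtain ⟨w, hw⟩ := exists_prime_orderOf_dvd_card (G := (ZMod p)ˣ) 3
      (by rw [ZMod.card_units]; omega)
    have hw3 : (w : ZMod p) ^ 3 = 1 := by
      have := pow_orderOf_eq_one w
      rw [hw] at this
      simpa using congrArg Units.val this
    have hw1 : (w : ZMod p) - 1 ≠ 0 := by
      intro h
      have : w = 1 := by ext; push_cast; linear_combination h
      rw [this, orderOf_one] at hw; omega
    have hw2 : (w : ZMod p) ^ 2 + w + 1 = 0 := by
      apply mul_left_cancel₀ hw1
      linear_combination hw3
    exact ⟨2 * w + 1, by linear_combination 4 * hw2⟩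
  set r := Nat.sqrt p with hr
  have hr1 : r * r ≤ p := Nat.sqrt_le p
  have hr2 : p < (r + 1) * (r + 1) := Nat.lt_succ_sqrt p
  have hr3 : r * r < p := by
    refine lt_of_le_of_ne hr1 ?_
    intro h
    rw [← h] at hp
    exact Nat.not_prime_mul (by rintro h'; rw [h'] at h; omega) (by rintro h'; rw [h'] at h; omega) hp
  obtain ⟨u, hu, v, hv, huv, he⟩ := Finset.exists_ne_map_eq_of_card_lt_of_maps_to
    (s := Finset.range (r + 1) ×ˢ Finset.range (r + 1)) (t := (Finset.univ : Finset (ZMod p)))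
    (by rw [Finset.card_product, Finset.card_range, Finset.card_univ, ZMod.card]; exact hr2)
    (f := fun u => (u.1 : ZMod p) - s * u.2) (fun _ _ => Finset.mem_univ _)
  simp only [Finset.mem_product, Finset.mem_range] at hu hv
  obtain ⟨x, hx⟩ : ∃ x : ℤ, x = u.1 - v.1 := ⟨_, rfl⟩
  obtain ⟨y, hy⟩ : ∃ y : ℤ, y = u.2 - v.2 := ⟨_, rfl⟩
  have hdvd : (p : ℤ) ∣ x ^ 2 + 3 * y ^ 2 := by
    rw [← ZMod.intCast_zmod_eq_zero_iff_dvd, hx, hy]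
    push_cast
    have : (u.1 : ZMod p) - v.1 = s * (u.2 - v.2) := by linear_combination he
    rw [this]
    linear_combination ((u.2 : ZMod p) - v.2) ^ 2 * hs
  have hne : 0 < x ^ 2 + 3 * y ^ 2 := by
    rcases eq_or_ne x 0 with h | h
    · have : y ≠ 0 := by
        intro h'; apply huv; ext <;> omega
      positivity
    · positivity
  have hxr : x ^ 2 ≤ r * r := by nlinarith [show -(r : ℤ) ≤ x by omega, show x ≤ r by omega]
  have hyr : y ^ 2 ≤ r * r := by nlinarith [show -(r : ℤ) ≤ y by omega, show y ≤ r by omega]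
  have hr3' : (r * r : ℤ) < p := by exact_mod_cast hr3
  obtain ⟨c, hc⟩ := hdvd
  have hc0 : 0 < c := by
    rw [hc] at hne
    exact pos_of_mul_pos_right hne (by positivity)
  have hc4 : c < 4 := by
    by_contra h
    push Not at h
    nlinarith
  have hpo : (p : ℤ) % 2 = 1 := by
    have := hp.eq_two_or_odd; omega
  interval_cases c
  · exact ⟨x, y, by linarith⟩
  · exfalso
    obtain ⟨q, hq⟩ : ∃ q : ℤ, (p : ℤ) = 2 * q + 1 := ⟨p / 2, by omega⟩
    have hx4 : x ^ 2 % 4 = 0 ∨ x ^ 2 % 4 = 1 := by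
      rcases Int.emod_two_eq_zero_or_one x with h | h
      · obtain ⟨t, rfl⟩ : ∃ t, x = 2 * t := ⟨x / 2, by omega⟩
        left; ring_nf; omega
      · obtain ⟨t, rfl⟩ : ∃ t, x = 2 * t + 1 := ⟨x / 2, by omega⟩
        right; ring_nf; omega
    have hy4 : y ^ 2 % 4 = 0 ∨ y ^ 2 % 4 = 1 := by
      rcases Int.emod_two_eq_zero_or_one y with h | h
      · obtain ⟨t, rfl⟩ : ∃ t, y = 2 * t := ⟨y / 2, by omega⟩
        left; ring_nf; omega
      · obtain ⟨t, rfl⟩ : ∃ t, y = 2 * t + 1 := ⟨y / 2, by omega⟩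
        right; ring_nf; omega
    omega
  · have h3 : (3 : ℤ) ∣ x := by
      apply Int.prime_three.dvd_of_dvd_pow (n := 2)
      exact ⟨p - y ^ 2, by linarith⟩
    obtain ⟨t, rfl⟩ := h3
    exact ⟨y, t, by linarith⟩

lemma rS_split (p : ℕ) (hp : p.Prime) (h2 : p ≠ 2) (h3 : p % 3 = 1) (m : ℤ) :
    (rS (p * m)).ncard + {v ∈ rS (p * m) | (p : ℤ) ∣ v.1 ∧ (p : ℤ) ∣ v.2}.ncard
      = 2 * (rS m).ncard := by
  obtain ⟨a, b, hab⟩ := split_ex p hp h2 h3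
  have hpi : Prime (p : ℤ) := Nat.prime_iff_prime_int.1 hp
  have hp0 : (p : ℤ) ≠ 0 := hpi.ne_zero
  have hpp : (0 : ℤ) < p := by exact_mod_cast hp.pos
  have hna : ¬ (p : ℤ) ∣ a := by
    intro h
    have hb : (p : ℤ) ∣ 3 * b ^ 2 := by
      have h' : (p : ℤ) ∣ a ^ 2 + 3 * b ^ 2 := ⟨1, by linarith⟩
      exact (Int.dvd_add_right (h.pow two_ne_zero)).1 h'
    have hb : (p : ℤ) ∣ b := by
      rcases hpi.dvd_or_dvd hb with h | h
      · have : p ∣ 3 := by exact_mod_cast h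
        have := (Nat.prime_dvd_prime_iff_eq hp Nat.prime_three).1 this
        omega
      · exact hpi.dvd_of_dvd_pow h
    obtain ⟨c, rfl⟩ := h
    obtain ⟨d, rfl⟩ := hb
    have h1 : (p : ℤ) * (c ^ 2 + 3 * d ^ 2) = 1 := by
      apply mul_left_cancel₀ hp0; linarith
    exact hpi.not_unit (IsUnit.of_mul_eq_one _ h1)
  have hn2 : ¬ (p : ℤ) ∣ 2 := by
    intro h
    have : p ∣ 2 := by exact_mod_cast h
    exact h2 ((Nat.prime_dvd_prime_iff_eq hp Nat.prime_two).1 this)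
  set A1 := {v ∈ rS (p * m) | (p : ℤ) ∣ a * v.2 - b * v.1} with hA1
  set A2 := {v ∈ rS (p * m) | (p : ℤ) ∣ a * v.2 + b * v.1} with hA2
  have f1 : A1.Finite := (rS_fin _).subset (Set.sep_subset _ _)
  have f2 : A2.Finite := (rS_fin _).subset (Set.sep_subset _ _)
  have hU : rS (p * m) = A1 ∪ A2 := by
    ext ⟨x, y⟩
    simp only [hA1, hA2, Set.mem_union, Set.mem_ofPred_eq]
    constructor
    · intro h
      rw [← and_or_left]
      refine ⟨h, hpi.dvd_or_dvd ?_⟩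
      simp only [rS, Set.mem_ofPred_eq] at h
      refine ⟨y ^ 2 - b ^ 2 * m, ?_⟩
      linear_combination y ^ 2 * hab - b ^ 2 * h
    · rintro (h | h) <;> exact h.1
  have hI : {v ∈ rS (p * m) | (p : ℤ) ∣ v.1 ∧ (p : ℤ) ∣ v.2} = A1 ∩ A2 := by
    ext ⟨x, y⟩
    simp only [hA1, hA2, Set.mem_inter_iff, Set.mem_ofPred_eq]
    constructor
    · rintro ⟨h, hx, hy⟩
      exact ⟨⟨h, dvd_sub (hy.mul_left _) (hx.mul_left _)⟩, ⟨h, dvd_add (hy.mul_left _) (hx.mul_left _)⟩⟩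
    · rintro ⟨⟨h, h1⟩, _, h2⟩
      have hy : (p : ℤ) ∣ y := by
        have : (p : ℤ) ∣ 2 * (a * y) := by
          have := dvd_add h1 h2
          ring_nf at this ⊢; exact this
        exact (hpi.dvd_or_dvd ((hpi.dvd_or_dvd this).resolve_left hn2)).resolve_left hna
      refine ⟨h, ?_, hy⟩
      simp only [rS, Set.mem_ofPred_eq] at h
      apply hpi.dvd_of_dvd_pow (n := 2)
      have h' : (p : ℤ) ∣ x ^ 2 + 3 * y ^ 2 := ⟨m, h⟩
      exact (Int.dvd_add_left ((hy.pow two_ne_zero).mul_left 3)).1 h'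
  have c12 : A2.ncard = A1.ncard := by
    apply nb (fun v => (v.1, -v.2)) (fun v => (v.1, -v.2))
    · rintro ⟨x, y⟩ ⟨h, h'⟩
      simp only [hA1, rS, Set.mem_ofPred_eq] at *
      refine ⟨by linarith, ?_⟩
      rw [← dvd_neg]; ring_nf at h' ⊢; exact h'
    · rintro ⟨x, y⟩ ⟨h, h'⟩
      simp only [hA2, rS, Set.mem_ofPred_eq] at *
      refine ⟨by linarith, ?_⟩
      rw [← dvd_neg]; ring_nf at h' ⊢; exact h'
    · rintro ⟨x, y⟩ _; simp
    · rintro ⟨x, y⟩ _; simp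
  have c1 : A1.ncard = (rS m).ncard := by
    have key : ∀ x y : ℤ, x ^ 2 + 3 * y ^ 2 = p * m → (p : ℤ) ∣ a * y - b * x →
        ∃ u v, a * x + 3 * b * y = p * u ∧ a * y - b * x = p * v := by
      rintro x y h ⟨v, hv⟩
      have : (p : ℤ) ∣ a * x + 3 * b * y := by
        apply hpi.dvd_of_dvd_pow (n := 2)
        refine ⟨p * m - 3 * p * v ^ 2, ?_⟩
        have e : (a * x + 3 * b * y) ^ 2 + 3 * (a * y - b * x) ^ 2 = p * (p * m) := by
          rw [← h]; nth_rewrite 1 [← hab]; ring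
        rw [hv] at e
        linarith
      obtain ⟨u, hu⟩ := this
      exact ⟨u, v, hu, hv⟩
    apply nb (fun v => ((a * v.1 + 3 * b * v.2) / p, (a * v.2 - b * v.1) / p))
      (fun v => (a * v.1 - 3 * b * v.2, a * v.2 + b * v.1))
    · rintro ⟨x, y⟩ ⟨h, h'⟩
      simp only [rS, Set.mem_ofPred_eq] at *
      obtain ⟨u, v, hu, hv⟩ := key x y h h'
      rw [hu, hv, Int.mul_ediv_cancel_left _ hp0, Int.mul_ediv_cancel_left _ hp0]
      have e : (a * x + 3 * b * y) ^ 2 + 3 * (a * y - b * x) ^ 2 = p * (p * m) := by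
        rw [← h]; nth_rewrite 1 [← hab]; ring
      rw [hu, hv] at e
      apply mul_left_cancel₀ hp0
      apply mul_left_cancel₀ hp0
      linarith
    · rintro ⟨u, v⟩ h
      simp only [hA1, rS, Set.mem_ofPred_eq] at *
      refine ⟨?_, v, ?_⟩
      · rw [← hab, ← h]; ring
      · rw [← hab]; ring
    · rintro ⟨x, y⟩ ⟨h, h'⟩
      simp only [rS, Set.mem_ofPred_eq] at *
      obtain ⟨u, v, hu, hv⟩ := key x y h h'
      rw [hu, hv, Int.mul_ediv_cancel_left _ hp0, Int.mul_ediv_cancel_left _ hp0]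
      simp only [Prod.mk.injEq]
      constructor
      · apply mul_left_cancel₀ hp0
        linear_combination x * hab - a * hu + 3 * b * hv
      · apply mul_left_cancel₀ hp0
        linear_combination y * hab - a * hv - b * hu
    · rintro ⟨u, v⟩ h
      simp only [Prod.mk.injEq]
      rw [show a * (a * u - 3 * b * v) + 3 * b * (a * v + b * u) = p * u by rw [← hab]; ring,
        show a * (a * v + b * u) - b * (a * u - 3 * b * v) = p * v by rw [← hab]; ring,
        Int.mul_ediv_cancel_left _ hp0, Int.mul_ediv_cancel_left _ hp0]
      exact ⟨rfl, rfl⟩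
  rw [hI]
  nth_rewrite 1 [hU]
  rw [Set.ncard_union_add_ncard_inter A1 A2 f1 f2, c12, c1, two_mul]

lemma rS_one : (rS 1).ncard = 2 := by
  have : rS 1 = {((1, 0) : ℤ × ℤ), (-1, 0)} := by
    ext ⟨x, y⟩
    simp only [rS, Set.mem_ofPred_eq, Set.mem_insert_iff, Set.mem_singleton_iff, Prod.mk.injEq]
    constructor
    · intro h
      have hy : y = 0 := by
        have : y < 1 := by nlinarith
        have : -1 < y := by nlinarith
        omega
      subst hy
      have : x < 2 := by nlinarith
      have : -2 < x := by nlinarith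
      interval_cases x <;> simp_all
    · rintro (⟨rfl, rfl⟩ | ⟨rfl, rfl⟩) <;> norm_num
  rw [this, Set.ncard_pair (by simp)]

lemma rS_gg (k : ℕ) (hk : k % 2 = 1) : ((rS k).ncard : ℤ) = 2 * gg k := by
  induction k using Nat.strong_induction_on with
  | _ k ih =>
  rcases eq_or_ne k 1 with rfl | h1
  · have := rS_one
    simp [this, gg, chi]
  obtain ⟨p, hp, m, rfl⟩ := Nat.exists_prime_and_dvd h1
  have hmo : m % 2 = 1 := by
    rcases Nat.mod_two_eq_zero_or_one m with h | h
    · rw [Nat.mul_mod, h] at hk; simp at hk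
    · exact h
  have hpo : p ≠ 2 := by rintro rfl; omega
  have hm0 : m ≠ 0 := by omega
  have hp2 := hp.two_le
  have ih1 := ih m (by nlinarith [Nat.pos_of_ne_zero hm0]) hmo
  rw [gg_rec p m hp hm0]
  push_cast
  have h3 : p % 3 < 3 := Nat.mod_lt _ (by norm_num)
  have ihd : ∀ e, m = p * e → ((rS e).ncard : ℤ) = 2 * gg e := by
    rintro e rfl
    have he : e % 2 = 1 := by
      rcases Nat.mod_two_eq_zero_or_one e with h | h
      · rw [Nat.mul_mod, h] at hmo; simp at hmo
      · exact h
    have he0 : 0 < e := by omega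
    exact ih e (by nlinarith [Nat.mul_pos hp.pos he0]) he
  rcases (by omega : p % 3 = 0 ∨ p % 3 = 1 ∨ p % 3 = 2) with h | h | h
  · have : p = 3 := ((Nat.prime_dvd_prime_iff_eq Nat.prime_three hp).1 (Nat.dvd_of_mod_eq_zero h)).symm
    subst this
    push_cast
    rw [rS3, ih1]; simp [chi]
  · have hs := rS_split p hp hpo h m
    have hchi : chi p = 1 := by simp [chi, h]
    rw [hchi]
    split_ifs with hd
    · obtain ⟨e, rfl⟩ := hd
      have := ihd e rfl
      push_cast at *
      rw [rS_scale p (by exact_mod_cast hp.ne_zero)] at hs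
      rw [Nat.mul_div_cancel_left _ hp.pos]
      have hs' : ((rS (p * (p * e))).ncard : ℤ) + (rS e).ncard = 2 * (rS (p * e)).ncard := by
        exact_mod_cast hs
      linarith
    · have h0 : {v ∈ rS (p * m) | (p : ℤ) ∣ v.1 ∧ (p : ℤ) ∣ v.2}.ncard = 0 := by
        rw [Set.ncard_eq_zero ((rS_fin _).subset (Set.sep_subset _ _))]
        ext ⟨x, y⟩
        simp only [rS, Set.mem_ofPred_eq, Set.mem_empty_iff_false, iff_false]
        rintro ⟨h, ⟨a, rfl⟩, ⟨b, rfl⟩⟩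
        apply hd
        have : (p : ℤ) ∣ m := by
          refine ⟨a ^ 2 + 3 * b ^ 2, ?_⟩
          have hp0 : (p : ℤ) ≠ 0 := by exact_mod_cast hp.ne_zero
          apply mul_left_cancel₀ hp0
          linarith
        exact_mod_cast this
      rw [h0] at hs
      have hs' : ((rS (p * m)).ncard : ℤ) = 2 * (rS m).ncard := by
        exact_mod_cast hs
      linarith
  · have hchi : chi p = -1 := by simp [chi, h]
    rw [hchi]
    split_ifs with hd
    · obtain ⟨e, rfl⟩ := hd
      have := ihd e rfl
      push_cast at *
      rw [Nat.mul_div_cancel_left _ hp.pos, rS_inert1 p hp hpo h, this]; ring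
    · rw [rS_inert0 p hp hpo h m (by exact_mod_cast hd)]; simp

abbrev Q4 := ℕ × ℕ × ℕ × ℕ

def bx (M : ℕ) : Finset Q4 :=
  Finset.range (M + 1) ×ˢ Finset.range (M + 1) ×ˢ Finset.range (M + 1) ×ˢ Finset.range (M + 1)

def LS (M : ℕ) : Finset Q4 := (bx M).filter (fun v =>
  v.1 % 2 = 1 ∧ v.2.1 % 2 = 1 ∧ v.2.2.1 % 2 = 1 ∧ v.2.2.2 % 2 = 1 ∧
    v.1 * v.2.1 + v.2.2.1 * v.2.2.2 = M)

def LTT (M : ℕ) : Finset Q4 := (bx M).filter (fun v =>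
  0 < v.1 ∧ 0 < v.2.2.2 ∧ v.1 % 2 = 0 ∧ v.2.1 % 2 = 1 ∧ v.2.2.1 % 2 = 1 ∧ v.2.2.2 % 2 = 0 ∧
    v.1 * v.2.1 + v.2.2.1 * v.2.2.2 = M)

lemma box_aux {M a b c d : ℕ} (ha : 0 < a) (hb : 0 < b) (hc : 0 < c) (hd : 0 < d)
    (h : a * b + c * d = M) : (a, b, c, d) ∈ bx M := by
  simp only [bx, Finset.mem_product, Finset.mem_range]
  have h1 := Nat.le_mul_of_pos_right a hb
  have h2 := Nat.le_mul_of_pos_left b ha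
  have h3 := Nat.le_mul_of_pos_right c hd
  have h4 := Nat.le_mul_of_pos_left d hc
  omega

lemma mem_LS {M a b c d : ℕ} : (a, b, c, d) ∈ LS M ↔
    a % 2 = 1 ∧ b % 2 = 1 ∧ c % 2 = 1 ∧ d % 2 = 1 ∧ a * b + c * d = M := by
  simp only [LS, Finset.mem_filter]
  constructor
  · exact fun h => h.2
  · rintro ⟨h1, h2, h3, h4, h5⟩
    exact ⟨box_aux (by omega) (by omega) (by omega) (by omega) h5, h1, h2, h3, h4, h5⟩

lemma mem_LT {M a b c d : ℕ} : (a, b, c, d) ∈ LTT M ↔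
    0 < a ∧ 0 < d ∧ a % 2 = 0 ∧ b % 2 = 1 ∧ c % 2 = 1 ∧ d % 2 = 0 ∧ a * b + c * d = M := by
  simp only [LTT, Finset.mem_filter]
  constructor
  · exact fun h => h.2
  · rintro ⟨h1, h2, h3, h4, h5, h6, h7⟩
    exact ⟨box_aux (by omega) (by omega) (by omega) (by omega) h7, h1, h2, h3, h4, h5, h6, h7⟩

lemma sum_tri {s : Finset Q4} (f g : Q4 → ℕ) (G : Q4 → ℤ) :
    ∑ v ∈ s, G v = ∑ v ∈ s.filter (fun v => f v = g v), G v
      + ∑ v ∈ s.filter (fun v => g v < f v), G v + ∑ v ∈ s.filter (fun v => f v < g v), G v := by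
  simp only [Finset.sum_filter, ← Finset.sum_add_distrib]
  refine Finset.sum_congr rfl fun v _ => ?_
  rcases lt_trichotomy (f v) (g v) with h | h | h
  · simp [h, h.ne, h.not_gt]
  · simp [h]
  · simp [h, h.ne', h.not_gt]

lemma L_swap1 (M : ℕ) (F : ℤ → ℤ) (hF : ∀ x, F (-x) = F x) :
    ∑ v ∈ (LS M).filter (fun v => v.1 < v.2.2.1), F ((v.1 : ℤ) - v.2.2.1) =
    ∑ v ∈ (LS M).filter (fun v => v.2.2.1 < v.1), F ((v.1 : ℤ) - v.2.2.1) := by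
  refine Finset.sum_nbij' (fun v => (v.2.2.1, v.2.2.2, v.1, v.2.1))
    (fun v => (v.2.2.1, v.2.2.2, v.1, v.2.1)) ?_ ?_ ?_ ?_ ?_
  · rintro ⟨a, b, c, d⟩ h
    simp only [Finset.mem_filter, mem_LS] at *
    exact ⟨⟨h.1.2.2.1, h.1.2.2.2.1, h.1.1, h.1.2.1, by linarith [h.1.2.2.2.2]⟩, h.2⟩
  · rintro ⟨a, b, c, d⟩ h
    simp only [Finset.mem_filter, mem_LS] at *
    exact ⟨⟨h.1.2.2.1, h.1.2.2.2.1, h.1.1, h.1.2.1, by linarith [h.1.2.2.2.2]⟩, h.2⟩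
  · rintro ⟨a, b, c, d⟩ _; rfl
  · rintro ⟨a, b, c, d⟩ _; rfl
  · rintro ⟨a, b, c, d⟩ _
    simp only
    rw [← hF]; congr 1; ring

lemma L_swap2 (M : ℕ) (F : ℤ → ℤ) :
    ∑ v ∈ (LS M).filter (fun v => v.2.1 < v.2.2.2), F ((v.1 : ℤ) + v.2.2.1) =
    ∑ v ∈ (LS M).filter (fun v => v.2.2.2 < v.2.1), F ((v.1 : ℤ) + v.2.2.1) := by
  refine Finset.sum_nbij' (fun v => (v.2.2.1, v.2.2.2, v.1, v.2.1))
    (fun v => (v.2.2.1, v.2.2.2, v.1, v.2.1)) ?_ ?_ ?_ ?_ ?_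
  · rintro ⟨a, b, c, d⟩ h
    simp only [Finset.mem_filter, mem_LS] at *
    exact ⟨⟨h.1.2.2.1, h.1.2.2.2.1, h.1.1, h.1.2.1, by linarith [h.1.2.2.2.2]⟩, h.2⟩
  · rintro ⟨a, b, c, d⟩ h
    simp only [Finset.mem_filter, mem_LS] at *
    exact ⟨⟨h.1.2.2.1, h.1.2.2.2.1, h.1.1, h.1.2.1, by linarith [h.1.2.2.2.2]⟩, h.2⟩
  · rintro ⟨a, b, c, d⟩ _; rfl
  · rintro ⟨a, b, c, d⟩ _; rfl
  · rintro ⟨a, b, c, d⟩ _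
    simp only
    congr 1; ring

lemma L_A (M : ℕ) (F : ℤ → ℤ) :
    ∑ v ∈ (LS M).filter (fun v => v.2.2.1 < v.1), F ((v.1 : ℤ) - v.2.2.1) =
    ∑ v ∈ (LTT M).filter (fun v => v.2.1 < v.2.2.2), F v.1 := by
  refine Finset.sum_nbij' (fun v => (v.1 - v.2.2.1, v.2.1, v.2.2.1, v.2.1 + v.2.2.2))
    (fun v => (v.1 + v.2.2.1, v.2.1, v.2.2.1, v.2.2.2 - v.2.1)) ?_ ?_ ?_ ?_ ?_
  · rintro ⟨a, b, c, d⟩ h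
    simp only [Finset.mem_filter, mem_LS, mem_LT] at *
    obtain ⟨⟨h1, h2, h3, h4, h5⟩, h6⟩ := h
    obtain ⟨e, rfl⟩ := Nat.exists_eq_add_of_lt h6
    rw [show c + e + 1 - c = e + 1 by omega]
    refine ⟨⟨?_, ?_, ?_, h2, h3, ?_, by linarith⟩, ?_⟩ <;> omega
  · rintro ⟨a, b, c, d⟩ h
    simp only [Finset.mem_filter, mem_LS, mem_LT] at *
    obtain ⟨⟨h1, h2, h3, h4, h5, h7, h8⟩, h6⟩ := h
    obtain ⟨e, rfl⟩ := Nat.exists_eq_add_of_lt h6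
    rw [show b + e + 1 - b = e + 1 by omega]
    refine ⟨⟨?_, h4, h5, ?_, by linarith⟩, ?_⟩ <;> omega
  · rintro ⟨a, b, c, d⟩ h
    simp only [Finset.mem_filter, Prod.mk.injEq] at *
    refine ⟨?_, trivial, trivial, ?_⟩ <;> omega
  · rintro ⟨a, b, c, d⟩ h
    simp only [Finset.mem_filter, Prod.mk.injEq] at *
    refine ⟨?_, trivial, trivial, ?_⟩ <;> omega
  · rintro ⟨a, b, c, d⟩ h
    simp only [Finset.mem_filter] at *
    congr 1; omega

lemma L_B (M : ℕ) (F : ℤ → ℤ) :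
    ∑ v ∈ (LS M).filter (fun v => v.2.2.2 < v.2.1), F ((v.1 : ℤ) + v.2.2.1) =
    ∑ v ∈ (LTT M).filter (fun v => v.2.2.1 < v.1), F v.1 := by
  refine Finset.sum_nbij' (fun v => (v.1 + v.2.2.1, v.2.2.2, v.1, v.2.1 - v.2.2.2))
    (fun v => (v.2.2.1, v.2.1 + v.2.2.2, v.1 - v.2.2.1, v.2.1)) ?_ ?_ ?_ ?_ ?_
  · rintro ⟨a, b, c, d⟩ h
    simp only [Finset.mem_filter, mem_LS, mem_LT] at *
    obtain ⟨⟨h1, h2, h3, h4, h5⟩, h6⟩ := h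
    obtain ⟨e, rfl⟩ := Nat.exists_eq_add_of_lt h6
    rw [show d + e + 1 - d = e + 1 by omega]
    refine ⟨⟨?_, ?_, ?_, h4, h1, ?_, by linarith⟩, ?_⟩ <;> omega
  · rintro ⟨a, b, c, d⟩ h
    simp only [Finset.mem_filter, mem_LS, mem_LT] at *
    obtain ⟨⟨h1, h2, h3, h4, h5, h7, h8⟩, h6⟩ := h
    obtain ⟨e, rfl⟩ := Nat.exists_eq_add_of_lt h6
    rw [show c + e + 1 - c = e + 1 by omega]
    refine ⟨⟨?_, ?_, ?_, ?_, by linarith⟩, ?_⟩ <;> omega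
  · rintro ⟨a, b, c, d⟩ h
    simp only [Finset.mem_filter, Prod.mk.injEq] at *
    refine ⟨trivial, ?_, ?_, trivial⟩ <;> omega
  · rintro ⟨a, b, c, d⟩ h
    simp only [Finset.mem_filter, Prod.mk.injEq] at *
    refine ⟨?_, trivial, trivial, ?_⟩ <;> omega
  · rintro ⟨a, b, c, d⟩ h
    simp only
    congr 1

lemma L_AB0 (M : ℕ) (F : ℤ → ℤ) :
    ∑ v ∈ (LTT M).filter (fun v => v.2.1 < v.2.2.2 ∧ ¬ v.2.2.1 < v.1), F v.1 =
    ∑ v ∈ (LTT M).filter (fun v => v.2.2.1 < v.1 ∧ ¬ v.2.1 < v.2.2.2), F v.1 := by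
  refine Finset.sum_nbij' (fun v => (v.1, v.2.1 + (v.2.2.1 / v.1) * v.2.2.2, v.2.2.1 % v.1, v.2.2.2))
    (fun v => (v.1, v.2.1 % v.2.2.2, v.2.2.1 + (v.2.1 / v.2.2.2) * v.1, v.2.2.2)) ?_ ?_ ?_ ?_ ?_
  · rintro ⟨a, b, c, d⟩ h
    simp only [Finset.mem_filter, mem_LT] at *
    obtain ⟨⟨h1, h2, h3, h4, h5, h7, h8⟩, h6, h9⟩ := h
    have e := Nat.div_add_mod c a
    have e1 : 1 ≤ c / a := (Nat.one_le_div_iff h1).2 (by omega)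
    have e2 := Nat.mod_lt c h1
    have e3 : c % a % 2 = 1 := by
      rw [Nat.mod_mod_of_dvd _ (Nat.dvd_of_mod_eq_zero h3)]; exact h5
    have e4 : c / a * d % 2 = 0 := by rw [Nat.mul_mod, h7]; simp
    have e5 : 1 * d ≤ c / a * d := Nat.mul_le_mul_right d e1
    refine ⟨⟨h1, h2, h3, by omega, e3, h7, ?_⟩, e2, by omega⟩
    rw [← h8]; nth_rewrite 3 [← e]; ring
  · rintro ⟨a, b, c, d⟩ h
    simp only [Finset.mem_filter, mem_LT] at *
    obtain ⟨⟨h1, h2, h3, h4, h5, h7, h8⟩, h6, h9⟩ := h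
    have e := Nat.div_add_mod b d
    have e1 : 1 ≤ b / d := (Nat.one_le_div_iff h2).2 (by omega)
    have e2 := Nat.mod_lt b h2
    have e3 : b % d % 2 = 1 := by
      rw [Nat.mod_mod_of_dvd _ (Nat.dvd_of_mod_eq_zero h7)]; exact h4
    have e4 : b / d * a % 2 = 0 := by rw [Nat.mul_mod, h3]; simp
    have e5 : 1 * a ≤ b / d * a := Nat.mul_le_mul_right a e1
    refine ⟨⟨h1, h2, h3, e3, by omega, h7, ?_⟩, e2, by omega⟩
    rw [← h8]; nth_rewrite 3 [← e]; ring
  · rintro ⟨a, b, c, d⟩ h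
    simp only [Finset.mem_filter, mem_LT, Prod.mk.injEq] at *
    obtain ⟨⟨h1, h2, h3, h4, h5, h7, h8⟩, h6, h9⟩ := h
    refine ⟨trivial, ?_, ?_, trivial⟩
    · rw [Nat.add_mul_mod_self_right, Nat.mod_eq_of_lt h6]
    · rw [Nat.add_mul_div_right _ _ h2, Nat.div_eq_of_lt h6, zero_add, mul_comm]
      exact Nat.mod_add_div c a
  · rintro ⟨a, b, c, d⟩ h
    simp only [Finset.mem_filter, mem_LT, Prod.mk.injEq] at *
    obtain ⟨⟨h1, h2, h3, h4, h5, h7, h8⟩, h6, h9⟩ := h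
    refine ⟨trivial, ?_, ?_, trivial⟩
    · rw [Nat.add_mul_div_right _ _ h1, Nat.div_eq_of_lt h6, zero_add, mul_comm]
      exact Nat.mod_add_div b d
    · rw [Nat.add_mul_mod_self_right, Nat.mod_eq_of_lt h6]
  · rintro ⟨a, b, c, d⟩ h
    rfl

lemma L_AB (M : ℕ) (F : ℤ → ℤ) :
    ∑ v ∈ (LTT M).filter (fun v => v.2.1 < v.2.2.2), F v.1 =
    ∑ v ∈ (LTT M).filter (fun v => v.2.2.1 < v.1), F v.1 := by
  rw [← Finset.sum_filter_add_sum_filter_not _ (fun v : Q4 => v.2.2.1 < v.1),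
    ← Finset.sum_filter_add_sum_filter_not ((LTT M).filter (fun v => v.2.2.1 < v.1))
      (fun v : Q4 => v.2.1 < v.2.2.2)]
  simp only [Finset.filter_filter]
  rw [L_AB0]
  congr 2
  ext v; simp only [Finset.mem_filter]; tauto

def LD (N : ℕ) : Finset ℕ := N.divisors.filter (fun e => (N / e) % 2 = 1)

lemma L_diag (N : ℕ) (hN : 0 < N) (F : ℤ → ℤ) :
    ∑ v ∈ (LS (2 * N)).filter (fun v => v.2.1 = v.2.2.2), F ((v.1 : ℤ) + v.2.2.1) =
    ∑ e ∈ LD N, (e : ℤ) * F (2 * e) := by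
  have : ∑ e ∈ LD N, (e : ℤ) * F (2 * e) = ∑ e ∈ LD N, ∑ i ∈ Finset.range e, F (2 * e) := by
    simp
  rw [this, Finset.sum_sigma']
  have key : ∀ a b c : ℕ, a % 2 = 1 → b % 2 = 1 → c % 2 = 1 → a * b + c * b = 2 * N →
      (a + c) / 2 * b = N := by
    intro a b c h1 h2 h3 h
    obtain ⟨e, he⟩ : ∃ e, a + c = 2 * e := ⟨(a + c) / 2, by omega⟩
    rw [he, Nat.mul_div_cancel_left _ (by norm_num)]
    have : (a + c) * b = 2 * N := by linarith
    rw [he] at this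
    linarith
  refine Finset.sum_nbij' (fun v => (⟨(v.1 + v.2.2.1) / 2, v.1 / 2⟩ : (_ : ℕ) × ℕ))
    (fun s => (2 * s.2 + 1, N / s.1, 2 * s.1 - 2 * s.2 - 1, N / s.1)) ?_ ?_ ?_ ?_ ?_
  · rintro ⟨a, b, c, d⟩ h
    simp only [Finset.mem_filter, mem_LS, Finset.mem_sigma, LD, Nat.mem_divisors, Finset.mem_range] at *
    obtain ⟨⟨h1, h2, h3, h4, h5⟩, rfl⟩ := h
    have k := key a b c h1 h2 h3 h5
    refine ⟨⟨⟨⟨b, k.symm⟩, by omega⟩, ?_⟩, by omega⟩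
    rw [← k, Nat.mul_div_cancel_left _ (by omega)]; exact h2
  · rintro ⟨e, i⟩ h
    simp only [Finset.mem_filter, mem_LS, Finset.mem_sigma, LD, Nat.mem_divisors, Finset.mem_range] at *
    obtain ⟨⟨⟨h1, _⟩, h2⟩, h3⟩ := h
    obtain ⟨q, rfl⟩ := h1
    rw [Nat.mul_div_cancel_left _ (by omega)] at *
    refine ⟨⟨by omega, h2, by omega, h2, ?_⟩, trivial⟩
    rw [← add_mul, show 2 * i + 1 + (2 * e - 2 * i - 1) = 2 * e by omega]; ring
  · rintro ⟨a, b, c, d⟩ h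
    simp only [Finset.mem_filter, mem_LS, Prod.mk.injEq] at *
    obtain ⟨⟨h1, h2, h3, h4, h5⟩, rfl⟩ := h
    have k := key a b c h1 h2 h3 h5
    have : N / ((a + c) / 2) = b := by
      rw [← k, Nat.mul_div_cancel_left _ (by omega)]
    refine ⟨by omega, this, by omega, this⟩
  · rintro ⟨e, i⟩ h
    simp only [Finset.mem_sigma, Finset.mem_range] at h
    have h' := h.2
    simp only [Sigma.mk.injEq, heq_eq_eq]
    constructor <;> omega
  · rintro ⟨a, b, c, d⟩ h
    simp only [Finset.mem_filter, mem_LS] at *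
    congr 1; omega

lemma L_diag' (N : ℕ) (hN : 0 < N) (F : ℤ → ℤ) :
    ∑ v ∈ (LS (2 * N)).filter (fun v => v.1 = v.2.2.1), F ((v.1 : ℤ) - v.2.2.1) =
    ∑ e ∈ LD N, (e : ℤ) * F 0 := by
  rw [← L_diag N hN (fun _ => F 0)]
  refine Finset.sum_nbij' (fun v => (v.2.1, v.1, v.2.2.2, v.2.2.1))
    (fun v => (v.2.1, v.1, v.2.2.2, v.2.2.1)) ?_ ?_ ?_ ?_ ?_
  · rintro ⟨a, b, c, d⟩ h
    simp only [Finset.mem_filter, mem_LS] at *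
    exact ⟨⟨h.1.2.1, h.1.1, h.1.2.2.2.1, h.1.2.2.1, by linarith [h.1.2.2.2.2]⟩, h.2⟩
  · rintro ⟨a, b, c, d⟩ h
    simp only [Finset.mem_filter, mem_LS] at *
    exact ⟨⟨h.1.2.1, h.1.1, h.1.2.2.2.1, h.1.2.2.1, by linarith [h.1.2.2.2.2]⟩, h.2⟩
  · rintro ⟨a, b, c, d⟩ _; rfl
  · rintro ⟨a, b, c, d⟩ _; rfl
  · rintro ⟨a, b, c, d⟩ h
    simp only [Finset.mem_filter] at *
    rw [h.2, sub_self]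

lemma liouville (N : ℕ) (hN : 0 < N) (F : ℤ → ℤ) (hF : ∀ x, F (-x) = F x) :
    ∑ v ∈ LS (2 * N), (F ((v.1 : ℤ) - v.2.2.1) - F ((v.1 : ℤ) + v.2.2.1)) =
    ∑ e ∈ LD N, (e : ℤ) * (F 0 - F (2 * e)) := by
  rw [Finset.sum_sub_distrib, sum_tri (fun v => v.1) (fun v => v.2.2.1)
    (fun v => F ((v.1 : ℤ) - v.2.2.1)), sum_tri (fun v => v.2.1) (fun v => v.2.2.2)
    (fun v => F ((v.1 : ℤ) + v.2.2.1)), L_swap1 _ F hF, L_swap2, L_A, L_B, L_AB, L_diag N hN,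
    L_diag' N hN]
  simp only [mul_sub, Finset.sum_sub_distrib]
  ring

lemma LS_chi (N : ℕ) (hN : 0 < N) :
    ∑ v ∈ LS (2 * N), chi v.1 * chi v.2.2.1 =
    ∑ e ∈ (LD N).filter (fun e => ¬ 3 ∣ e), (e : ℤ) := by
  have := liouville N hN (fun x => if x % 3 = 0 then 1 else 0)
    (by intro x; simp only [show (-x) % 3 = 0 ↔ x % 3 = 0 by omega])
  rw [Finset.sum_filter]
  calc _ = _ := ?_
    _ = _ := this
    _ = _ := ?_
  · refine Finset.sum_congr rfl fun v _ => ?_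
    unfold chi
    have h1 : v.1 % 3 < 3 := Nat.mod_lt _ (by norm_num)
    have h2 : v.2.2.1 % 3 < 3 := Nat.mod_lt _ (by norm_num)
    split_ifs <;> first | rfl | omega
  · refine Finset.sum_congr rfl fun e _ => ?_
    simp only [Nat.dvd_iff_mod_eq_zero]
    split_ifs <;> first | simp | omega
    all_goals omega

lemma LS_gg (M : ℕ) (hM : M % 2 = 0) :
    ∑ k ∈ (Finset.range (M + 1)).filter (fun k => k % 2 = 1), gg k * gg (M - k) =
    ∑ v ∈ LS M, chi v.1 * chi v.2.2.1 := by
  have : ∀ k, gg k * gg (M - k) = ∑ q ∈ k.divisors ×ˢ (M - k).divisors, chi q.1 * chi q.2 := by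
    intro k
    rw [gg, gg, Finset.sum_mul_sum, Finset.sum_product]
  simp only [this]
  rw [Finset.sum_sigma']
  symm
  have odd : ∀ a b : ℕ, a * b % 2 = 1 ↔ a % 2 = 1 ∧ b % 2 = 1 := by
    intro a b
    rw [Nat.mul_mod]
    rcases Nat.mod_two_eq_zero_or_one a with h | h <;>
    rcases Nat.mod_two_eq_zero_or_one b with h' | h' <;> simp [h, h']
  refine Finset.sum_nbij' (fun v => (⟨v.1 * v.2.1, (v.1, v.2.2.1)⟩ : (_ : ℕ) × (ℕ × ℕ)))
    (fun s => (s.2.1, s.1 / s.2.1, s.2.2, (M - s.1) / s.2.2)) ?_ ?_ ?_ ?_ ?_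
  · rintro ⟨a, b, c, d⟩ h
    simp only [mem_LS, Finset.mem_sigma, Finset.mem_filter, Finset.mem_range, Finset.mem_product,
      Nat.mem_divisors] at *
    obtain ⟨h1, h2, h3, h4, h5⟩ := h
    have o1 := (odd a b).2 ⟨h1, h2⟩
    have o2 := (odd c d).2 ⟨h3, h4⟩
    have : M - a * b = c * d := by omega
    rw [this]
    exact ⟨⟨by omega, o1⟩, ⟨Dvd.intro _ rfl, by omega⟩, Dvd.intro _ rfl, by omega⟩
  · rintro ⟨k, a, c⟩ h
    simp only [mem_LS, Finset.mem_sigma, Finset.mem_filter, Finset.mem_range, Finset.mem_product,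
      Nat.mem_divisors] at *
    obtain ⟨⟨h1, h2⟩, ⟨⟨b, rfl⟩, h4⟩, ⟨d, h5⟩, h6⟩ := h
    have o1 := (odd a b).1 h2
    have o2 := (odd c d).1 (by omega)
    rw [h5, Nat.mul_div_cancel_left _ (by omega), Nat.mul_div_cancel_left _ (by omega)]
    exact ⟨o1.1, o1.2, o2.1, o2.2, by omega⟩
  · rintro ⟨a, b, c, d⟩ h
    simp only [mem_LS, Prod.mk.injEq] at *
    obtain ⟨h1, h2, h3, h4, h5⟩ := h
    have : M - a * b = c * d := by omega
    rw [this, Nat.mul_div_cancel_left _ (by omega), Nat.mul_div_cancel_left _ (by omega)]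
    exact ⟨trivial, rfl, trivial, rfl⟩
  · rintro ⟨k, a, c⟩ h
    simp only [Finset.mem_sigma, Finset.mem_product, Nat.mem_divisors] at h
    simp only [Nat.mul_div_cancel' h.2.1.1]
  · rintro ⟨a, b, c, d⟩ _; rfl

lemma LD_sum (α β n1 : ℕ) (h2 : ¬ 2 ∣ n1) (h3 : ¬ 3 ∣ n1) :
    ∑ e ∈ (LD (2 ^ α * 3 ^ β * n1)).filter (fun e => ¬ 3 ∣ e), e = 2 ^ α * ∑ d ∈ n1.divisors, d := by
  have hn : n1 ≠ 0 := by rintro rfl; simp at h2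
  have e : (LD (2 ^ α * 3 ^ β * n1)).filter (fun e => ¬ 3 ∣ e) =
      n1.divisors.image (fun d => 2 ^ α * d) := by
    ext d
    simp only [LD, Finset.mem_filter, Finset.mem_image, Nat.mem_divisors]
    constructor
    · rintro ⟨⟨⟨⟨q, hq⟩, _⟩, ho⟩, hd3⟩
      have hd0 : 0 < d := by
        rcases Nat.eq_zero_or_pos d with rfl | h
        · simp at hd3
        · exact h
      rw [hq, Nat.mul_div_cancel_left _ hd0] at ho
      have c1 : (2 ^ α).Coprime q := by
        apply Nat.Coprime.pow_left
        rw [Nat.coprime_two_left]; exact Nat.odd_iff.2 ho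
      have : 2 ^ α ∣ d := by
        apply c1.dvd_of_dvd_mul_right
        rw [← hq, mul_assoc]; exact Dvd.intro _ rfl
      obtain ⟨e, rfl⟩ := this
      refine ⟨e, ⟨?_, hn⟩, rfl⟩
      have he3 : ¬ 3 ∣ e := fun h => hd3 (h.mul_left _)
      have c3 : e.Coprime (3 ^ β) := by
        apply Nat.Coprime.pow_right
        exact ((Nat.prime_three.coprime_iff_not_dvd).2 he3).symm
      apply c3.dvd_of_dvd_mul_left
      refine ⟨q, ?_⟩
      apply Nat.eq_of_mul_eq_mul_left (show 0 < 2 ^ α by positivity)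
      linarith
    · rintro ⟨e, ⟨⟨f, rfl⟩, _⟩, rfl⟩
      have he0 : 0 < e := by
        rcases Nat.eq_zero_or_pos e with rfl | h
        · simp at hn
        · exact h
      have eq : 2 ^ α * 3 ^ β * (e * f) = 2 ^ α * e * (3 ^ β * f) := by ring
      refine ⟨⟨⟨⟨_, eq⟩, by positivity⟩, ?_⟩, ?_⟩
      · rw [eq, Nat.mul_div_cancel_left _ (by positivity)]
        apply Nat.odd_iff.1
        refine Odd.mul (Odd.pow (by decide)) ?_
        rw [← Nat.not_even_iff_odd, even_iff_two_dvd]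
        exact fun h => h2 (h.mul_left _)
      · intro h
        rcases (Nat.Prime.dvd_mul Nat.prime_three).1 h with h | h
        · have := Nat.prime_three.dvd_of_dvd_pow h
          omega
        · exact h3 (h.mul_right _)
  rw [e, Finset.sum_image, Finset.mul_sum]
  intro a _ b _ h
  exact Nat.eq_of_mul_eq_mul_left (show 0 < 2 ^ α by positivity) h

lemma t1133_val (n : ℤ) (hn : 0 < n) (α β n1 : ℕ) (h2 : ¬ 2 ∣ n1) (h3 : ¬ 3 ∣ n1)
    (h : n + 1 = (2 : ℤ) ^ α * 3 ^ β * n1) :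
    t4 1 1 3 3 n = 2 ^ (α + 4) * (∑ d ∈ n1.divisors, d) := by
  obtain ⟨N, hN⟩ : ∃ N : ℕ, N = 2 ^ α * 3 ^ β * n1 := ⟨_, rfl⟩
  have hnN : n + 1 = N := by rw [h, hN]; push_cast; rfl
  have hN0 : 0 < N := by omega
  have key : ((∑ k ∈ (Finset.Icc 0 (2 * n + 2)).filter (fun k => k % 2 = 1),
      (rS k).ncard * (rS (2 * n + 2 - k)).ncard : ℕ) : ℤ) =
      4 * ∑ k ∈ (Finset.range (2 * N + 1)).filter (fun k => k % 2 = 1), gg k * gg (2 * N - k) := by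
    rw [Finset.mul_sum]
    push_cast
    refine Finset.sum_nbij' (fun k => k.toNat) (fun k => (k : ℤ)) ?_ ?_ ?_ ?_ ?_
    · intro k hk
      simp only [Finset.mem_filter, Finset.mem_Icc, Finset.mem_range] at *
      omega
    · intro k hk
      simp only [Finset.mem_filter, Finset.mem_Icc, Finset.mem_range] at *
      omega
    · intro k hk
      simp only [Finset.mem_filter, Finset.mem_Icc] at *
      omega
    · intro k hk
      simp
    · intro k hk
      simp only [Finset.mem_filter, Finset.mem_Icc] at hk
      obtain ⟨m, rfl⟩ := Int.eq_ofNat_of_zero_le hk.1.1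
      have e : 2 * n + 2 - (m : ℤ) = ((2 * N - m : ℕ) : ℤ) := by omega
      rw [e, rS_gg m (by omega), rS_gg (2 * N - m) (by omega), Int.toNat_natCast]
      ring
  rw [LS_gg _ (by omega), LS_chi N hN0, hN] at key
  have e2 := LD_sum α β n1 h2 h3
  rw [t1133_r]
  have e3 : (∑ e ∈ (LD (2 ^ α * 3 ^ β * n1)).filter (fun e => ¬ 3 ∣ e), (e : ℤ)) =
      2 ^ α * ∑ d ∈ n1.divisors, (d : ℤ) := by
    rw [← Nat.cast_sum, e2]; push_cast; rfl
  zify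
  push_cast at key
  rw [key, e3]
  ring

theorem stmt18 (n : ℤ) (hn : 0 < n) :
    t4 2 3 3 8 (2*n) + t4 1 1 6 24 (2*n - 2) = t4 1 1 3 3 n ∧
    (∀ (α β n1 : ℕ), ¬ 2 ∣ n1 → ¬ 3 ∣ n1 →
      n + 1 = (2 : ℤ) ^ α * 3 ^ β * n1 →
      t4 1 1 6 24 (2*n - 2) + t4 2 3 3 8 (2*n) = 2 ^ (α + 4) * (∑ d ∈ n1.divisors, d)) := by
  refine ⟨part1 n, fun α β n1 h2 h3 h => ?_⟩
  rw [add_comm, part1 n]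
  exact t1133_val n hn α β n1 h2 h3 h
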